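/- There exists a polynomial p : ℕ → ℕ such that for every finite alphabet Σ there is a function learner mapping each finite nonempty set of trees over Σ that all have the same root label to a disjunctive multiplicity schema over Σ with: (soundness) for every such set D, D ⊆ L(learner(D)); and (completeness) for every DMS S over Σ there exists a finite set CS_S ⊆ L(S) with |CS_S| ≤ p(|Σ|) such that for every finite set D with CS_S ⊆ D ⊆ L(S), L(learner(D)) = L(S). -/

import Mathlib

namespace LSXML

/-- A multiplicity: one of `*`, `+`, `?`, `1`, `0`. -/
inductive Mult : Type
  | star | plus | opt | one | zero
  deriving DecidableEq

/-- The set of natural numbers `⟦M⟧` denoted by a multiplicity `M`. -/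
def Mult.sem : Mult → Set ℕ
  | .star => Set.univ
  | .plus => {n | 1 ≤ n}
  | .opt  => {0, 1}
  | .one  => {1}
  | .zero => {0}

/-- A disjunctive multiplicity expression (DME) `D₁^{M₁} ∥ ⋯ ∥ D_n^{M_n}` where each
`D_i` is a nonempty disjunction `a₁^{M'₁} | ⋯ | a_k^{M'_k}` of symbols with
multiplicities, and every symbol of the alphabet occurs at most once in the
whole expression. -/
structure DME (α : Type) : Type where
  factors : List (List (α × Mult) × Mult)
  nonemptyDisj : ∀ d ∈ factors, d.1 ≠ []
  distinct : (factors.flatMap fun d => d.1.map Prod.fst).Nodup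

/-- `L(a^M) = {a^i : i ∈ ⟦M⟧}`. -/
def atomLang {α : Type} (a : α) (M : Mult) : Set (Multiset α) :=
  {w | ∃ i ∈ Mult.sem M, w = Multiset.replicate i a}

/-- `L(a₁^{M₁} | ⋯ | a_k^{M_k}) = L(a₁^{M₁}) ∪ ⋯ ∪ L(a_k^{M_k})`. -/
def disjLang {α : Type} (d : List (α × Mult)) : Set (Multiset α) :=
  {w | ∃ p ∈ d, w ∈ atomLang p.1 p.2}

/-- `L(D^M)`: multiset unions of `i` words of `L(D)`, for `i ∈ ⟦M⟧`. -/
def powLang {α : Type} (L : Set (Multiset α)) (M : Mult) : Set (Multiset α) :=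
  {w | ∃ ws : List (Multiset α), ws.length ∈ Mult.sem M ∧ (∀ u ∈ ws, u ∈ L) ∧ w = ws.sum}

/-- Unordered concatenation (elementwise multiset union) of a list of languages. -/
def concatLang {α : Type} : List (Set (Multiset α)) → Set (Multiset α)
  | [] => {0}
  | L :: Ls => {w | ∃ u ∈ L, ∃ v ∈ concatLang Ls, w = u + v}

/-- The language of unordered words of a DME. -/
def DME.lang {α : Type} (E : DME α) : Set (Multiset α) :=
  concatLang (E.factors.map fun d => powLang (disjLang d.1) d.2)

/-- A disjunction-free multiplicity expression `a₁^{M₁} ∥ ⋯ ∥ a_k^{M_k}` with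
pairwise distinct symbols. -/
structure MExpr (α : Type) : Type where
  entries : List (α × Mult)
  distinct : (entries.map Prod.fst).Nodup

/-- The language of a disjunction-free multiplicity expression: multisets `w`
with `w(a_i) ∈ ⟦M_i⟧` for each entry `a_i^{M_i}` and `w(b) = 0` for every other
symbol `b`. -/
def MExpr.lang {α : Type} [DecidableEq α] (e : MExpr α) : Set (Multiset α) :=
  {w | (∀ p ∈ e.entries, w.count p.1 ∈ Mult.sem p.2) ∧
       ∀ b : α, b ∉ e.entries.map Prod.fst → w.count b = 0}

/-- Finite rooted labeled trees. The list of children is to be understood as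
unordered: its order is irrelevant for satisfaction of multiplicity schemas. -/
inductive UTree (α : Type) : Type
  | node : α → List (UTree α) → UTree α

/-- The label of the root of a tree. -/
def UTree.label {α : Type} : UTree α → α
  | .node a _ => a

/-- A tree satisfies a family of DME rules if for every node, the multiset of
labels of its children belongs to the language of the rule of its label. -/
inductive UTree.Sat {α : Type} (R : α → DME α) : UTree α → Prop
  | node (a : α) (ts : List (UTree α)) :
      ((ts.map UTree.label : List α) : Multiset α) ∈ (R a).lang →
      (∀ t ∈ ts, UTree.Sat R t) →
      UTree.Sat R (UTree.node a ts)

/-- A disjunctive multiplicity schema (DMS): a root label together with a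
DME rule for every symbol of the alphabet. -/
structure DMS (α : Type) : Type where
  root : α
  rules : α → DME α

/-- The set `L(S)` of trees satisfying a DMS `S`. -/
def DMS.lang {α : Type} (S : DMS α) : Set (UTree α) :=
  {t | t.label = S.root ∧ UTree.Sat S.rules t}

/-- Satisfaction of a family of disjunction-free rules. -/
inductive UTree.MSat {α : Type} [DecidableEq α] (R : α → MExpr α) : UTree α → Prop
  | node (a : α) (ts : List (UTree α)) :
      ((ts.map UTree.label : List α) : Multiset α) ∈ (R a).lang →
      (∀ t ∈ ts, UTree.MSat R t) →
      UTree.MSat R (UTree.node a ts)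

/-- A disjunction-free multiplicity schema (MS). -/
structure MS (α : Type) : Type where
  root : α
  rules : α → MExpr α

/-- The set `L(S)` of trees satisfying an MS `S`. -/
def MS.lang {α : Type} [DecidableEq α] (S : MS α) : Set (UTree α) :=
  {t | t.label = S.root ∧ UTree.MSat S.rules t}


/-- A sample for schema learning: a finite nonempty set of trees all having the
same root label. -/
def TreeSample (α : Type) : Type :=
  {D : Finset (UTree α) // D.Nonempty ∧ ∃ r : α, ∀ t ∈ D, t.label = r}

open Classical in
/-- Normal-form description of a language of unordered words. -/
structure Prof (α : Type) : Type where
  alive : α → Prop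
  big : α → Prop
  confl : α → α → Prop
  req : Finset (Finset α)
  symm : ∀ a b, confl a b → confl b a
  irr : ∀ a, ¬ confl a a
  disj : ∀ A ∈ req, ∀ B ∈ req, ∀ x, x ∈ A → x ∈ B → A = B
  reqAlive : ∀ A ∈ req, ∀ x ∈ A, alive x
  closed : ∀ A ∈ req, ∀ x ∈ A, ∀ y, alive y → confl x y → y ∈ A

open Classical in
def Prof.lang {α : Type} (P : Prof α) : Set (Multiset α) :=
  {w | (∀ a ∈ w, P.alive a) ∧ (∀ a, ¬ P.big a → w.count a ≤ 1) ∧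
    (∀ a ∈ w, ∀ b ∈ w, ¬ P.confl a b) ∧ ∀ A ∈ P.req, ∃ a ∈ A, a ∈ w}

open Classical in
noncomputable def Prof.s {α : Type} (P : Prof α) (d : Finset α → α) (X : Finset α) : Finset α :=
  X ∪ (P.req.filter (fun A => ∀ x ∈ X, x ∉ A)).image d

theorem Prof.s_mem {α : Type} (P : Prof α) (d : Finset α → α) (hd : ∀ A ∈ P.req, d A ∈ A)
    (X : Finset α) (hX : ∀ x ∈ X, P.alive x) (hc : ∀ x ∈ X, ∀ y ∈ X, ¬ P.confl x y) :
    (P.s d X).val ∈ P.lang := by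
  classical
  have key : ∀ x, x ∈ P.s d X ↔ x ∈ X ∨ ∃ A ∈ P.req, (∀ x ∈ X, x ∉ A) ∧ d A = x := by
    intro x
    simp [Prof.s, and_assoc]
  refine ⟨?_, ?_, ?_, ?_⟩
  · intro a ha
    rcases (key a).1 ha with h | ⟨A, hA, -, rfl⟩
    · exact hX a h
    · exact P.reqAlive A hA _ (hd A hA)
  · intro a _
    exact Multiset.nodup_iff_count_le_one.1 (P.s d X).nodup a
  · intro a ha b hb hab
    rcases (key a).1 ha with h | ⟨A, hA, hAX, rfl⟩
    · rcases (key b).1 hb with h' | ⟨B, hB, hBX, rfl⟩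
      · exact hc a h b h' hab
      · exact hBX a h (P.closed B hB _ (hd B hB) a (hX a h) (P.symm _ _ hab))
    · rcases (key b).1 hb with h' | ⟨B, hB, hBX, rfl⟩
      · exact hAX b h' (P.closed A hA _ (hd A hA) b (hX b h') hab)
      · have := P.closed A hA _ (hd A hA) _ (P.reqAlive B hB _ (hd B hB)) hab
        have := P.disj A hA B hB _ this (hd B hB)
        subst this
        exact P.irr _ hab
  · intro A hA
    by_cases h : ∀ x ∈ X, x ∉ A
    · exact ⟨d A, hd A hA, (key _).2 (Or.inr ⟨A, hA, h, rfl⟩)⟩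
    · push Not at h
      obtain ⟨x, hx, hxA⟩ := h
      exact ⟨x, hxA, (key _).2 (Or.inl hx)⟩

open Classical in
noncomputable def Prof.cs {α : Type} [Fintype α] (P : Prof α) (d : Finset α → α) : Finset (Multiset α) :=
  insert (P.s d ∅).val
    (((Finset.univ : Finset (α × α)).filter
        (fun q => P.alive q.1 ∧ P.alive q.2 ∧ ¬ P.confl q.1 q.2)).image
          (fun q => (P.s d {q.1, q.2}).val) ∪
     ((Finset.univ : Finset α).filter (fun a => P.alive a ∧ P.big a)).image
          (fun a => (P.s d {a}).val + {a}))

theorem Prof.cs_card {α : Type} [Fintype α] (P : Prof α) (d : Finset α → α) :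
    (P.cs d).card ≤ Fintype.card α ^ 2 + Fintype.card α + 1 := by
  classical
  unfold Prof.cs
  refine (Finset.card_insert_le _ _).trans (Nat.add_le_add_right ?_ 1)
  refine (Finset.card_union_le _ _).trans (Nat.add_le_add ?_ ?_)
  · refine Finset.card_image_le.trans ((Finset.card_filter_le _ _).trans ?_)
    simp [sq]
  · exact Finset.card_image_le.trans (Finset.card_filter_le _ _)

theorem Prof.cs_sub {α : Type} [Fintype α] (P : Prof α) (d : Finset α → α)
    (hd : ∀ A ∈ P.req, d A ∈ A) : ∀ w ∈ P.cs d, w ∈ P.lang := by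
  classical
  intro w hw
  simp only [Prof.cs, Finset.mem_insert, Finset.mem_union, Finset.mem_image, Finset.mem_filter,
    Finset.mem_univ, true_and] at hw
  rcases hw with rfl | ⟨⟨a, b⟩, ⟨h1, h2, h3⟩, rfl⟩ | ⟨a, ⟨h1, h2⟩, rfl⟩
  · exact P.s_mem d hd _ (by simp) (by simp)
  · refine P.s_mem d hd _ ?_ ?_
    · intro x hx
      simp only [Finset.mem_insert, Finset.mem_singleton] at hx
      rcases hx with rfl | rfl <;> assumption
    · intro x hx y hy
      simp only [Finset.mem_insert, Finset.mem_singleton] at hx hy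
      rcases hx with rfl | rfl <;> rcases hy with rfl | rfl
      · exact P.irr _
      · exact h3
      · exact fun h => h3 (P.symm _ _ h)
      · exact P.irr _
  · have hs := P.s_mem d hd {a} (by simpa using h1) (by simpa using P.irr a)
    have ha : a ∈ (P.s d {a}).val := by
      show a ∈ P.s d {a}
      simp [Prof.s]
    have hm : ∀ x, x ∈ (P.s d {a}).val + {a} ↔ x ∈ (P.s d {a}).val := by
      intro x
      simp only [Multiset.mem_add, Multiset.mem_singleton]
      constructor
      · rintro (h | rfl) <;> assumption
      · exact Or.inl
    obtain ⟨p1, p2, p3, p4⟩ := hs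
    refine ⟨?_, ?_, ?_, ?_⟩
    · intro x hx; exact p1 x ((hm x).1 hx)
    · intro x hx
      have hne : x ≠ a := by rintro rfl; exact hx h2
      rw [Multiset.count_add, Multiset.count_singleton, if_neg hne]
      exact p2 x hx
    · intro x hx y hy; exact p3 x ((hm x).1 hx) y ((hm y).1 hy)
    · intro A hA
      obtain ⟨x, hx, hx'⟩ := p4 A hA
      exact ⟨x, hx, (hm x).2 hx'⟩

/-- Transversal counting lemma. -/
theorem transversal {α : Type} (𝒜 ℬ : Finset (Finset α)) (hcard : 𝒜.card ≤ ℬ.card)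
    (hB : ∀ A ∈ ℬ, ∀ B ∈ ℬ, ∀ x, x ∈ A → x ∈ B → A = B) (r : Finset α → α)
    (hr : ∀ B ∈ ℬ, ∃ A ∈ 𝒜, r A ∈ B) :
    (∀ A ∈ 𝒜, ∃ B ∈ ℬ, r A ∈ B) ∧
    (∀ B ∈ ℬ, ∀ A₁ ∈ 𝒜, ∀ A₂ ∈ 𝒜, r A₁ ∈ B → r A₂ ∈ B → A₁ = A₂) := by
  classical
  choose! f hf hf' using hr
  have hinj : Set.InjOn f ℬ := by
    intro B hB1 B' hB2 h
    exact hB B hB1 B' hB2 (r (f B)) (hf' B hB1) (by rw [h]; exact hf' B' hB2)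
  have himg : ℬ.image f = 𝒜 := by
    apply Finset.eq_of_subset_of_card_le
    · intro A hA
      obtain ⟨B, hB, rfl⟩ := Finset.mem_image.1 hA
      exact hf B hB
    · rw [Finset.card_image_of_injOn hinj]; exact hcard
  have h1 : ∀ A ∈ 𝒜, ∃ B ∈ ℬ, f B = A := by
    intro A hA
    rw [← himg] at hA
    simpa using hA
  refine ⟨?_, ?_⟩
  · intro A hA
    obtain ⟨B, hB, rfl⟩ := h1 A hA
    exact ⟨B, hB, hf' B hB⟩
  · intro B hBm A₁ hA₁ A₂ hA₂ h₁ h₂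
    obtain ⟨B₁, hB₁, rfl⟩ := h1 A₁ hA₁
    obtain ⟨B₂, hB₂, rfl⟩ := h1 A₂ hA₂
    rw [hB _ hB₁ _ hBm _ (hf' _ hB₁) h₁, hB _ hB₂ _ hBm _ (hf' _ hB₂) h₂]

theorem Prof.card_le {α : Type} (P Q : Prof α) (d : Finset α → α)
    (h : (P.s d ∅).val ∈ Q.lang) : Q.req.card ≤ P.req.card := by
  classical
  have h2 : ∀ B ∈ Q.req, ∃ A ∈ P.req, d A ∈ B := by
    intro B hB
    obtain ⟨x, hx, hx'⟩ := h.2.2.2 B hB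
    have : x ∈ P.s d ∅ := hx'
    simp [Prof.s] at this
    obtain ⟨A, hA, rfl⟩ := this
    exact ⟨A, hA, hx⟩
  choose! f hf hf' using h2
  apply Finset.card_le_card_of_injOn f hf
  intro B hB1 B' hB2 hh
  exact Q.disj B hB1 B' hB2 (d (f B)) (hf' B hB1) (by rw [hh]; exact hf' B' hB2)

theorem Prof.sub_req {α : Type} [Fintype α] (P Q : Prof α) (d : Finset α → α)
    (hd : ∀ A ∈ P.req, d A ∈ A) (h : ∀ w ∈ P.cs d, w ∈ Q.lang)
    (hcard : P.req.card ≤ Q.req.card) : ∀ A ∈ P.req, ∃ B ∈ Q.req, A ⊆ B := by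
  classical
  have h0 : ∀ B ∈ Q.req, ∃ A ∈ P.req, d A ∈ B := by
    intro B hB
    have hm : (P.s d ∅).val ∈ Q.lang := h _ (by simp [Prof.cs])
    obtain ⟨x, hx, hx'⟩ := hm.2.2.2 B hB
    have : x ∈ P.s d ∅ := hx'
    simp [Prof.s] at this
    obtain ⟨A, hA, rfl⟩ := this
    exact ⟨A, hA, hx⟩
  obtain ⟨t1, t2⟩ := transversal P.req Q.req hcard Q.disj d h0
  intro A hA
  obtain ⟨B, hB, hAB⟩ := t1 A hA
  refine ⟨B, hB, ?_⟩
  intro a ha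
  have hr : ∀ B ∈ Q.req, ∃ A' ∈ P.req, (Function.update d A a) A' ∈ B := by
    intro B hB
    have hm : (P.s d {a, a}).val ∈ Q.lang := h _ (by
      simp only [Prof.cs, Finset.mem_insert, Finset.mem_union, Finset.mem_image,
        Finset.mem_filter, Finset.mem_univ, true_and]
      refine Or.inr (Or.inl ⟨(a, a), ⟨?_, ?_, P.irr a⟩, rfl⟩) <;> exact P.reqAlive A hA a ha)
    obtain ⟨x, hx, hx'⟩ := hm.2.2.2 B hB
    have : x ∈ P.s d {a, a} := hx'
    simp [Prof.s] at this
    rcases this with rfl | ⟨A', ⟨hA', haA'⟩, rfl⟩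
    · exact ⟨A, hA, by simpa using hx⟩
    · refine ⟨A', hA', ?_⟩
      rw [Function.update_of_ne]
      · exact hx
      · rintro rfl; exact haA' ha
  obtain ⟨u1, u2⟩ := transversal P.req Q.req hcard Q.disj _ hr
  obtain ⟨B', hB', haB'⟩ := u1 A hA
  rw [Function.update_self] at haB'
  by_cases hBB : B' = B
  · subst hBB; exact haB'
  · exfalso
    obtain ⟨A', hA', hdA'⟩ := h0 B' hB'
    have hne : A' ≠ A := by
      rintro rfl
      exact hBB (Q.disj _ hB' _ hB _ hdA' hAB)
    apply hne
    apply u2 B' hB' A' hA' A hA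
    · rw [Function.update_of_ne hne]; exact hdA'
    · rw [Function.update_self]; exact haB'

theorem Prof.req_sub {α : Type} [Fintype α] (P Q : Prof α) (d e : Finset α → α)
    (hd : ∀ A ∈ P.req, d A ∈ A) (he : ∀ A ∈ Q.req, e A ∈ A) (h : ∀ w ∈ P.cs d, w ∈ Q.lang)
    (h' : ∀ w ∈ Q.cs e, w ∈ P.lang) : P.req ⊆ Q.req := by
  have c1 := P.card_le Q d (h _ (by simp [Prof.cs]))
  have c2 := Q.card_le P e (h' _ (by simp [Prof.cs]))
  intro A hA
  obtain ⟨B, hB, hAB⟩ := P.sub_req Q d hd h c2 A hA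
  obtain ⟨C, hC, hBC⟩ := Q.sub_req P e he h' c1 B hB
  have : A = C := P.disj A hA C hC (d A) (hd A hA) (hBC (hAB (hd A hA)))
  subst this
  rwa [Finset.Subset.antisymm hAB hBC]

theorem Prof.lang_sub {α : Type} [Fintype α] (P Q : Prof α) (d e : Finset α → α)
    (hd : ∀ A ∈ P.req, d A ∈ A) (he : ∀ A ∈ Q.req, e A ∈ A) (h : ∀ w ∈ P.cs d, w ∈ Q.lang)
    (h' : ∀ w ∈ Q.cs e, w ∈ P.lang) : P.lang ⊆ Q.lang := by
  classical
  have hreq := Q.req_sub P e d he hd h' h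
  have hpair : ∀ a b, P.alive a → P.alive b → ¬ P.confl a b → (P.s d {a, b}).val ∈ Q.lang := by
    intro a b ha hb hab
    apply h
    simp only [Prof.cs, Finset.mem_insert, Finset.mem_union, Finset.mem_image,
        Finset.mem_filter, Finset.mem_univ, true_and]
    exact Or.inr (Or.inl ⟨(a, b), ⟨ha, hb, hab⟩, rfl⟩)
  have hin : ∀ a b, a ∈ (P.s d {a, b}).val ∧ b ∈ (P.s d {a, b}).val := by
    intro a b
    constructor
    · show a ∈ P.s d {a, b}
      simp [Prof.s]
    · show b ∈ P.s d {a, b}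
      simp [Prof.s]
  rintro w ⟨p1, p2, p3, p4⟩
  refine ⟨?_, ?_, ?_, ?_⟩
  · intro a ha
    exact (hpair a a (p1 a ha) (p1 a ha) (P.irr a)).1 a (hin a a).1
  · intro a ha
    by_cases hw : a ∈ w
    · apply p2
      intro hb
      have : (P.s d {a}).val + {a} ∈ Q.lang := by
        apply h
        simp only [Prof.cs, Finset.mem_insert, Finset.mem_union, Finset.mem_image,
            Finset.mem_filter, Finset.mem_univ, true_and]
        exact Or.inr (Or.inr ⟨a, ⟨p1 a hw, hb⟩, rfl⟩)
      have := this.2.1 a ha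
      rw [Multiset.count_add, Multiset.count_singleton_self] at this
      have h3 : 0 < (P.s d {a}).val.count a := by
        rw [Multiset.count_pos]
        show a ∈ P.s d {a}
        simp [Prof.s]
      omega
    · rw [Multiset.count_eq_zero_of_notMem hw]; omega
  · intro a ha b hb
    exact (hpair a b (p1 a ha) (p1 b hb) (p3 a ha b hb)).2.2.1 a (hin a b).1 b (hin a b).2
  · intro A hA
    exact p4 A (hreq hA)

/-- `C` is a characteristic set of words for `L`. -/
def IsCS {α : Type} [Fintype α] (L : Set (Multiset α)) (C : Finset (Multiset α)) : Prop :=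
  ∃ (P : Prof α) (d : Finset α → α), P.lang = L ∧ (∀ A ∈ P.req, d A ∈ A) ∧ C = P.cs d

theorem IsCS.unique {α : Type} [Fintype α] {L L' : Set (Multiset α)} {C C' : Finset (Multiset α)}
    (h : IsCS L C) (h' : IsCS L' C') (h1 : ∀ w ∈ C, w ∈ L') (h2 : ∀ w ∈ C', w ∈ L) : L = L' := by
  obtain ⟨P, d, rfl, hd, rfl⟩ := h
  obtain ⟨Q, e, rfl, he, rfl⟩ := h'
  exact Set.Subset.antisymm (P.lang_sub Q d e hd he h1 h2) (Q.lang_sub P e d he hd h2 h1)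

open Classical in
theorem IsCS.exists {α : Type} [Fintype α] [Nonempty α] (P : Prof α) (N : α → Prop)
    (hne : ∃ w ∈ P.lang, ∀ a ∈ w, N a) :
    ∃ C, IsCS {w | w ∈ P.lang ∧ ∀ a ∈ w, N a} C := by
  obtain ⟨w, hw, hN⟩ := hne
  let Q : Prof α :=
    { alive := fun a => P.alive a ∧ N a
      big := P.big
      confl := P.confl
      req := P.req.image (fun A => A.filter N)
      symm := P.symm
      irr := P.irr
      disj := by
        intro A hA B hB x hxA hxB
        obtain ⟨A, hA0, rfl⟩ := Finset.mem_image.1 hA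
        obtain ⟨B, hB0, rfl⟩ := Finset.mem_image.1 hB
        rw [P.disj A hA0 B hB0 x (Finset.mem_filter.1 hxA).1 (Finset.mem_filter.1 hxB).1]
      reqAlive := by
        intro A hA x hx
        obtain ⟨A, hA0, rfl⟩ := Finset.mem_image.1 hA
        rw [Finset.mem_filter] at hx
        exact ⟨P.reqAlive A hA0 x hx.1, hx.2⟩
      closed := by
        intro A hA x hx y hy hxy
        obtain ⟨A, hA0, rfl⟩ := Finset.mem_image.1 hA
        rw [Finset.mem_filter] at hx ⊢
        exact ⟨P.closed A hA0 x hx.1 y hy.1 hxy, hy.2⟩ }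
  have hQ : Q.lang = {w | w ∈ P.lang ∧ ∀ a ∈ w, N a} := by
    ext v
    constructor
    · rintro ⟨p1, p2, p3, p4⟩
      refine ⟨⟨fun a ha => (p1 a ha).1, p2, p3, ?_⟩, fun a ha => (p1 a ha).2⟩
      intro A hA
      obtain ⟨a, ha, ha'⟩ := p4 _ (Finset.mem_image_of_mem _ hA)
      exact ⟨a, (Finset.mem_filter.1 ha).1, ha'⟩
    · rintro ⟨⟨p1, p2, p3, p4⟩, p5⟩
      refine ⟨fun a ha => ⟨p1 a ha, p5 a ha⟩, p2, p3, ?_⟩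
      intro A hA
      obtain ⟨A, hA0, rfl⟩ := Finset.mem_image.1 hA
      obtain ⟨a, ha, ha'⟩ := p4 A hA0
      exact ⟨a, Finset.mem_filter.2 ⟨ha, p5 a ha'⟩, ha'⟩
  have hwQ : w ∈ Q.lang := by rw [hQ]; exact ⟨hw, hN⟩
  have : ∀ A, ∃ x, A ∈ Q.req → x ∈ A := by
    intro A
    by_cases hA : A ∈ Q.req
    · obtain ⟨a, ha, -⟩ := hwQ.2.2.2 A hA
      exact ⟨a, fun _ => ha⟩
    · exact ⟨Classical.arbitrary α, fun h => absurd h hA⟩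
  choose d hd using this
  exact ⟨_, Q, d, hQ, hd, rfl⟩

theorem IsCS.card {α : Type} [Fintype α] {L : Set (Multiset α)} {C : Finset (Multiset α)}
    (h : IsCS L C) : C.card ≤ Fintype.card α ^ 2 + Fintype.card α + 1 := by
  obtain ⟨P, d, rfl, hd, rfl⟩ := h
  exact P.cs_card d

theorem IsCS.sub {α : Type} [Fintype α] {L : Set (Multiset α)} {C : Finset (Multiset α)}
    (h : IsCS L C) : ∀ w ∈ C, w ∈ L := by
  obtain ⟨P, d, rfl, hd, rfl⟩ := h
  exact P.cs_sub d hd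

open Classical in
theorem Prof.concat {α : Type} (P Q : Prof α) (hPQ : ∀ a, P.alive a → Q.alive a → False) :
    ∃ T : Prof α, (∀ a, T.alive a → P.alive a ∨ Q.alive a) ∧
      T.lang = {w | ∃ u ∈ P.lang, ∃ v ∈ Q.lang, w = u + v} := by
  let T : Prof α :=
    { alive := fun a => P.alive a ∨ Q.alive a
      big := fun a => (P.alive a ∧ P.big a) ∨ (Q.alive a ∧ Q.big a)
      confl := fun a b => (P.alive a ∧ P.alive b ∧ P.confl a b) ∨
        (Q.alive a ∧ Q.alive b ∧ Q.confl a b)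
      req := P.req ∪ Q.req
      symm := by
        rintro a b (⟨h1, h2, h3⟩ | ⟨h1, h2, h3⟩)
        · exact Or.inl ⟨h2, h1, P.symm _ _ h3⟩
        · exact Or.inr ⟨h2, h1, Q.symm _ _ h3⟩
      irr := by
        rintro a (⟨h1, h2, h3⟩ | ⟨h1, h2, h3⟩)
        · exact P.irr _ h3
        · exact Q.irr _ h3
      disj := by
        intro A hA B hB x hxA hxB
        rcases Finset.mem_union.1 hA with hA | hA <;> rcases Finset.mem_union.1 hB with hB | hB
        · exact P.disj A hA B hB x hxA hxB
        · exact (hPQ x (P.reqAlive A hA x hxA) (Q.reqAlive B hB x hxB)).elim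
        · exact (hPQ x (P.reqAlive B hB x hxB) (Q.reqAlive A hA x hxA)).elim
        · exact Q.disj A hA B hB x hxA hxB
      reqAlive := by
        intro A hA x hx
        rcases Finset.mem_union.1 hA with hA | hA
        · exact Or.inl (P.reqAlive A hA x hx)
        · exact Or.inr (Q.reqAlive A hA x hx)
      closed := by
        intro A hA x hx y hy hxy
        rcases Finset.mem_union.1 hA with hA | hA <;>
          rcases hxy with ⟨h1, h2, h3⟩ | ⟨h1, h2, h3⟩
        · exact P.closed A hA x hx y h2 h3
        · exact (hPQ x (P.reqAlive A hA x hx) h1).elim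
        · exact (hPQ x h1 (Q.reqAlive A hA x hx)).elim
        · exact Q.closed A hA x hx y h2 h3 }
  refine ⟨T, fun a h => h, ?_⟩
  ext w
  constructor
  · rintro ⟨p1, p2, p3, p4⟩
    have hQv : ∀ a ∈ w.filter (fun a => ¬ P.alive a), Q.alive a := by
      intro a ha
      rw [Multiset.mem_filter] at ha
      exact (p1 a ha.1).resolve_left ha.2
    refine ⟨w.filter P.alive, ⟨?_, ?_, ?_, ?_⟩, w.filter (fun a => ¬ P.alive a),
      ⟨hQv, ?_, ?_, ?_⟩, (Multiset.filter_add_not _ _).symm⟩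
    · intro a ha
      exact (Multiset.mem_filter.1 ha).2
    · intro a ha
      by_cases h : P.alive a
      · refine (Multiset.count_le_of_le a (Multiset.filter_le _ _)).trans (p2 a ?_)
        rintro (h' | h')
        · exact ha h'.2
        · exact hPQ a h h'.1
      · rw [Multiset.count_eq_zero_of_notMem]
        · omega
        · intro h'; exact h (Multiset.mem_filter.1 h').2
    · intro a ha b hb hab
      rw [Multiset.mem_filter] at ha hb
      exact p3 a ha.1 b hb.1 (Or.inl ⟨ha.2, hb.2, hab⟩)
    · intro A hA
      obtain ⟨a, ha, ha'⟩ := p4 A (Finset.mem_union_left _ hA)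
      exact ⟨a, ha, Multiset.mem_filter.2 ⟨ha', P.reqAlive A hA a ha⟩⟩
    · intro a ha
      by_cases h : Q.alive a
      · refine (Multiset.count_le_of_le a (Multiset.filter_le _ _)).trans (p2 a ?_)
        rintro (h' | h')
        · exact hPQ a h'.1 h
        · exact ha h'.2
      · rw [Multiset.count_eq_zero_of_notMem]
        · omega
        · intro h'; exact h (hQv a h')
    · intro a ha b hb hab
      exact p3 a (Multiset.mem_filter.1 ha).1 b (Multiset.mem_filter.1 hb).1
        (Or.inr ⟨hQv a ha, hQv b hb, hab⟩)
    · intro A hA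
      obtain ⟨a, ha, ha'⟩ := p4 A (Finset.mem_union_right _ hA)
      exact ⟨a, ha, Multiset.mem_filter.2 ⟨ha', fun h => hPQ a h (Q.reqAlive A hA a ha)⟩⟩
  · rintro ⟨u, ⟨p1, p2, p3, p4⟩, v, ⟨q1, q2, q3, q4⟩, rfl⟩
    refine ⟨?_, ?_, ?_, ?_⟩
    · intro a ha
      rcases Multiset.mem_add.1 ha with h | h
      · exact Or.inl (p1 a h)
      · exact Or.inr (q1 a h)
    · intro a ha
      rw [Multiset.count_add]
      by_cases hu : a ∈ u
      · have hv : a ∉ v := fun hv => hPQ a (p1 a hu) (q1 a hv)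
        rw [Multiset.count_eq_zero_of_notMem hv]
        exact p2 a (fun h => ha (Or.inl ⟨p1 a hu, h⟩))
      · rw [Multiset.count_eq_zero_of_notMem hu, zero_add]
        by_cases hv : a ∈ v
        · exact q2 a (fun h => ha (Or.inr ⟨q1 a hv, h⟩))
        · rw [Multiset.count_eq_zero_of_notMem hv]; omega
    · rintro a ha b hb (⟨h1, h2, h3⟩ | ⟨h1, h2, h3⟩)
      · refine p3 a ?_ b ?_ h3
        · exact (Multiset.mem_add.1 ha).resolve_right (fun h => hPQ a h1 (q1 a h))
        · exact (Multiset.mem_add.1 hb).resolve_right (fun h => hPQ b h2 (q1 b h))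
      · refine q3 a ?_ b ?_ h3
        · exact (Multiset.mem_add.1 ha).resolve_left (fun h => hPQ a (p1 a h) h1)
        · exact (Multiset.mem_add.1 hb).resolve_left (fun h => hPQ b (p1 b h) h2)
    · intro A hA
      rcases Finset.mem_union.1 hA with hA | hA
      · obtain ⟨a, h, h'⟩ := p4 A hA
        exact ⟨a, h, Multiset.mem_add.2 (Or.inl h')⟩
      · obtain ⟨a, h, h'⟩ := q4 A hA
        exact ⟨a, h, Multiset.mem_add.2 (Or.inr h')⟩

theorem Mult.one_mem {m : Mult} (h : m ≠ .zero) : 1 ∈ m.sem := by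
  cases m <;> simp_all [Mult.sem]

theorem mem_disj {α : Type} (d : List (α × Mult)) (u : Multiset α) :
    u ∈ disjLang d ↔ ∃ a m, (a, m) ∈ d ∧ ∃ i ∈ m.sem, u = Multiset.replicate i a := by
  simp [disjLang, atomLang]

theorem alive_of_mem {α : Type} {d : List (α × Mult)} {u : Multiset α} (h : u ∈ disjLang d)
    {a : α} (ha : a ∈ u) : ∃ m, (a, m) ∈ d ∧ m ≠ .zero := by
  obtain ⟨b, m, hm, i, hi, rfl⟩ := (mem_disj d u).1 h
  obtain ⟨h0, rfl⟩ := Multiset.mem_replicate.1 ha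
  refine ⟨m, hm, ?_⟩
  rintro rfl
  exact h0 hi

theorem zero_mem_disj {α : Type} (d : List (α × Mult)) :
    (0 : Multiset α) ∈ disjLang d ↔ ∃ p ∈ d, 0 ∈ p.2.sem := by
  rw [mem_disj]
  constructor
  · rintro ⟨a, m, h, i, hi, h0⟩
    have : i = 0 := by simpa using (congrArg Multiset.card h0).symm
    subst this
    exact ⟨_, h, hi⟩
  · rintro ⟨⟨a, m⟩, h, h0⟩
    exact ⟨a, m, h, 0, h0, by simp⟩

open Classical in
theorem disj_iff {α : Type} (d : List (α × Mult)) (hd : (d.map Prod.fst).Nodup)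
    (w : Multiset α) :
    w ∈ disjLang d ↔ (∀ a ∈ w, ∃ m, (a, m) ∈ d ∧ m ≠ .zero) ∧
      (∀ a, ¬ (∃ m, (a, m) ∈ d ∧ (m = .star ∨ m = .plus)) → w.count a ≤ 1) ∧
      (∀ a ∈ w, ∀ b ∈ w, a = b) ∧ (w = 0 → ∃ p ∈ d, 0 ∈ p.2.sem) := by
  constructor
  · intro h
    refine ⟨fun a ha => alive_of_mem h ha, ?_, ?_, ?_⟩
    · intro a ha
      obtain ⟨b, m, hm, i, hi, rfl⟩ := (mem_disj d w).1 h
      rw [Multiset.count_replicate]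
      split_ifs with hab
      · subst hab
        cases m
        · exact absurd ⟨_, hm, Or.inl rfl⟩ ha
        · exact absurd ⟨_, hm, Or.inr rfl⟩ ha
        all_goals simp [Mult.sem] at hi; omega
      · omega
    · intro a ha b hb
      obtain ⟨c, m, hm, i, hi, rfl⟩ := (mem_disj d w).1 h
      rw [Multiset.eq_of_mem_replicate ha, Multiset.eq_of_mem_replicate hb]
    · rintro rfl
      exact (zero_mem_disj d).1 h
  · rintro ⟨h1, h2, h3, h4⟩
    by_cases h0 : w = 0
    · subst h0
      exact (zero_mem_disj d).2 (h4 rfl)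
    · obtain ⟨a, ha⟩ := Multiset.exists_mem_of_ne_zero h0
      obtain ⟨m, hm, hmz⟩ := h1 a ha
      rw [mem_disj]
      have hw : w = Multiset.replicate (w.count a) a := by
        have : w = Multiset.replicate (Multiset.card w) a :=
          Multiset.eq_replicate.2 ⟨rfl, fun b hb => h3 b hb a ha⟩
        rw [this]
        simp
      refine ⟨a, m, hm, w.count a, ?_, hw⟩
      have hpos : 0 < w.count a := Multiset.count_pos.2 ha
      by_cases hb : m = .star ∨ m = .plus
      · rcases hb with rfl | rfl
        · simp [Mult.sem]
        · exact hpos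
      · have h5 : w.count a ≤ 1 := by
          apply h2
          rintro ⟨m', hm', hb'⟩
          have := List.inj_on_of_nodup_map hd hm hm' rfl
          have : m = m' := (Prod.ext_iff.1 this).2
          subst this
          exact hb hb'
        have : w.count a = 1 := by omega
        rw [this]
        exact Mult.one_mem hmz

theorem pow_big {α : Type} (d : List (α × Mult)) (M : Mult) (hM : M = .star ∨ M = .plus)
    (hne : d ≠ []) (w : Multiset α) :
    w ∈ powLang (disjLang d) M ↔ (∀ a ∈ w, ∃ m, (a, m) ∈ d ∧ m ≠ .zero) ∧
      (M = .plus → w = 0 → ∃ p ∈ d, 0 ∈ p.2.sem) := by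
  have memsum : ∀ (ws : List (Multiset α)) (a : α), a ∈ ws.sum ↔ ∃ u ∈ ws, a ∈ u := by
    intro ws a
    induction ws with
    | nil => simp
    | cons u us ih => simp [ih]
  constructor
  · rintro ⟨ws, hl, hws, rfl⟩
    refine ⟨?_, ?_⟩
    · intro a ha
      obtain ⟨u, hu, hau⟩ := (memsum _ _).1 ha
      exact alive_of_mem (hws u hu) hau
    · rintro rfl h0
      cases ws with
      | nil => simp [Mult.sem] at hl
      | cons u us =>
        have hu : u = 0 := by
          apply Multiset.eq_zero_of_forall_notMem
          intro a ha
          have : a ∈ (u :: us).sum := (memsum _ _).2 ⟨u, by simp, ha⟩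
          rw [h0] at this
          simp at this
        have := hws u (by simp)
        rw [hu] at this
        exact (zero_mem_disj d).1 this
  · rintro ⟨h1, h2⟩
    by_cases h : M = .plus ∧ w = 0
    · obtain ⟨rfl, rfl⟩ := h
      exact ⟨[0], by simp [Mult.sem], by simpa using (zero_mem_disj d).2 (h2 rfl rfl), by simp⟩
    · refine ⟨w.toList.map (fun a => {a}), ?_, ?_, ?_⟩
      · rcases hM with rfl | rfl
        · simp [Mult.sem]
        · simp only [true_and] at h
          simp only [Mult.sem, List.length_map, Multiset.length_toList, Set.mem_ofPred_eq]
          exact Multiset.card_pos.2 h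
      · intro u hu
        simp only [List.mem_map, Multiset.mem_toList] at hu
        obtain ⟨a, ha, rfl⟩ := hu
        obtain ⟨m, hm, hz⟩ := h1 a ha
        exact (mem_disj d _).2 ⟨a, m, hm, 1, Mult.one_mem hz, by simp⟩
      · conv_lhs => rw [← Multiset.coe_toList w]
        generalize w.toList = l
        induction l with
        | nil => simp
        | cons a l ih =>
          rw [List.map_cons, List.sum_cons, ← ih]
          simp

theorem pow_small {α : Type} (L : Set (Multiset α)) (M : Mult) (hM : M = .one ∨ M = .opt)
    (w : Multiset α) : w ∈ powLang L M ↔ w ∈ L ∨ (M = .opt ∧ w = 0) := by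
  constructor
  · rintro ⟨ws, hl, h, rfl⟩
    match ws, hl, h with
    | [], hl, h =>
      rcases hM with rfl | rfl
      · simp [Mult.sem] at hl
      · exact Or.inr ⟨rfl, rfl⟩
    | [u], hl, h =>
      left
      simpa using h u (by simp)
    | u :: v :: ws, hl, h =>
      rcases hM with rfl | rfl <;> simp [Mult.sem] at hl
  · rintro (h | ⟨rfl, rfl⟩)
    · exact ⟨[w], by rcases hM with rfl | rfl <;> simp [Mult.sem], by simpa using h, by simp⟩
    · exact ⟨[], by simp [Mult.sem], by simp, by simp⟩

open Classical in
theorem factor_prof {α : Type} (d : List (α × Mult)) (M : Mult) (hne : d ≠ [])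
    (hd : (d.map Prod.fst).Nodup) :
    ∃ T : Prof α, (∀ a, T.alive a → a ∈ d.map Prod.fst) ∧
      T.lang = powLang (disjLang d) M := by
  have hs : ∀ {a : α}, (∃ m, (a, m) ∈ d ∧ m ≠ Mult.zero) → a ∈ d.map Prod.fst := by
    rintro a ⟨m, hm, -⟩
    exact List.mem_map.2 ⟨_, hm, rfl⟩
  have hreq : ∀ A ∈ (if (M = .one ∨ M = .plus) ∧ ∀ p ∈ d, 0 ∉ p.2.sem then
      {(d.map Prod.fst).toFinset} else (∅ : Finset (Finset α))),
      A = (d.map Prod.fst).toFinset ∧ (M = .one ∨ M = .plus) ∧ ∀ p ∈ d, 0 ∉ p.2.sem := by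
    intro A hA
    split_ifs at hA with h
    · exact ⟨Finset.mem_singleton.1 hA, h⟩
    · simp at hA
  let T : Prof α :=
    { alive := fun a => M ≠ .zero ∧ ∃ m, (a, m) ∈ d ∧ m ≠ .zero
      big := fun a => (M = .star ∨ M = .plus) ∨ ∃ m, (a, m) ∈ d ∧ (m = .star ∨ m = .plus)
      confl := fun a b => ¬ (M = .star ∨ M = .plus) ∧ a ≠ b
      req := if (M = .one ∨ M = .plus) ∧ ∀ p ∈ d, 0 ∉ p.2.sem then
        {(d.map Prod.fst).toFinset} else ∅
      symm := fun a b h => ⟨h.1, h.2.symm⟩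
      irr := fun a h => h.2 rfl
      disj := by
        intro A hA B hB x _ _
        rw [(hreq A hA).1, (hreq B hB).1]
      reqAlive := by
        intro A hA x hx
        obtain ⟨rfl, h1, h2⟩ := hreq A hA
        refine ⟨by rcases h1 with rfl | rfl <;> simp, ?_⟩
        rw [List.mem_toFinset, List.mem_map] at hx
        obtain ⟨⟨a, m⟩, hm, rfl⟩ := hx
        refine ⟨m, hm, ?_⟩
        rintro rfl
        exact h2 _ hm (by simp [Mult.sem])
      closed := by
        intro A hA x hx y hy hxy
        obtain ⟨rfl, h1, h2⟩ := hreq A hA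
        rw [List.mem_toFinset]
        exact hs hy.2 }
  refine ⟨T, fun a h => hs h.2, ?_⟩
  have hT : ∀ w : Multiset α, (∀ a ∈ w, ∃ m, (a, m) ∈ d ∧ m ≠ Mult.zero) →
      ((∀ A ∈ T.req, ∃ a ∈ A, a ∈ w) ↔
        ((M = .one ∨ M = .plus) → w = 0 → ∃ p ∈ d, 0 ∈ p.2.sem)) := by
    intro w hw
    constructor
    · rintro h hM rfl
      by_contra hcon
      push Not at hcon
      have : (d.map Prod.fst).toFinset ∈ T.req := by
        show _ ∈ (if _ then _ else _)
        rw [if_pos ⟨hM, hcon⟩]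
        simp
      obtain ⟨a, -, ha⟩ := h _ this
      simp at ha
    · intro h A hA
      obtain ⟨rfl, h1, h2⟩ := hreq A hA
      have h0 : w ≠ 0 := by
        intro h0
        obtain ⟨p, hp, hp'⟩ := h h1 h0
        exact h2 p hp hp'
      obtain ⟨a, ha⟩ := Multiset.exists_mem_of_ne_zero h0
      exact ⟨a, List.mem_toFinset.2 (hs (hw a ha)), ha⟩
  ext w
  by_cases hM : M = .star ∨ M = .plus
  · rw [pow_big d M hM hne]
    constructor
    · rintro ⟨p1, p2, p3, p4⟩
      have h1 := fun a ha => (p1 a ha).2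
      exact ⟨h1, fun h => (hT w h1).1 p4 (Or.inr h)⟩
    · rintro ⟨h1, h2⟩
      refine ⟨fun a ha => ⟨by rcases hM with rfl | rfl <;> simp, h1 a ha⟩,
        fun a ha => absurd (Or.inl hM) ha, fun a _ b _ h => h.1 hM, (hT w h1).2 ?_⟩
      intro h
      apply h2
      rcases h with rfl | rfl
      · simp at hM
      · rfl
  · by_cases hz : M = .zero
    · subst hz
      have : w ∈ powLang (disjLang d) .zero ↔ w = 0 := by
        constructor
        · rintro ⟨ws, hl, -, rfl⟩
          have : ws = [] := by simpa [Mult.sem] using hl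
          simp [this]
        · rintro rfl
          exact ⟨[], by simp [Mult.sem], by simp, by simp⟩
      rw [this]
      constructor
      · rintro ⟨p1, -⟩
        apply Multiset.eq_zero_of_forall_notMem
        intro a ha
        exact (p1 a ha).1 rfl
      · rintro rfl
        exact ⟨by simp, by simp, by simp, (hT 0 (by simp)).2 (by simp)⟩
    · have h01 := pow_small (disjLang d) M (by cases M <;> simp at hM hz ⊢) w
      rw [h01, disj_iff d hd]
      constructor
      · rintro ⟨p1, p2, p3, p4⟩
        have h1 := fun a ha => (p1 a ha).2
        have h4 := (hT w h1).1 p4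
        by_cases hc : M = .opt ∧ w = 0
        · exact Or.inr hc
        · left
          refine ⟨h1, ?_, ?_, ?_⟩
          · intro a ha
            exact p2 a (fun h => h.elim hM ha)
          · intro a ha b hb
            by_contra hab
            exact p3 a ha b hb ⟨hM, hab⟩
          · intro h0
            refine h4 ?_ h0
            have hc' : M ≠ .opt := fun h => hc ⟨h, h0⟩
            cases M <;> simp at hM hz hc' ⊢
      · rintro (⟨h1, h2, h3, h4⟩ | ⟨rfl, rfl⟩)
        · refine ⟨fun a ha => ⟨hz, h1 a ha⟩, ?_, ?_, (hT w h1).2 (fun _ => h4)⟩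
          · intro a ha
            exact h2 a (fun h => ha (Or.inr h))
          · intro a ha b hb h
            exact h.2 (h3 a ha b hb)
        · exact ⟨by simp, by simp, by simp, (hT 0 (by simp)).2 (by simp)⟩

theorem factors_prof {α : Type} (fs : List (List (α × Mult) × Mult))
    (hne : ∀ d ∈ fs, d.1 ≠ []) (hd : (fs.flatMap fun d => d.1.map Prod.fst).Nodup) :
    ∃ T : Prof α, (∀ a, T.alive a → a ∈ fs.flatMap fun d => d.1.map Prod.fst) ∧
      T.lang = concatLang (fs.map fun d => powLang (disjLang d.1) d.2) := by
  induction fs with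
  | nil =>
    refine ⟨⟨fun _ => False, fun _ => True, fun _ _ => False, ∅, by simp, by simp, by simp,
      by simp, by simp⟩, by simp, ?_⟩
    ext w
    simp only [Prof.lang, concatLang, List.map_nil, Set.mem_ofPred_eq, Set.mem_singleton_iff]
    constructor
    · rintro ⟨h, -⟩
      exact Multiset.eq_zero_of_forall_notMem h
    · rintro rfl
      simp
  | cons f fs ih =>
    rw [List.flatMap_cons, List.nodup_append] at hd
    obtain ⟨Q, hQ, hQl⟩ := ih (fun d h => hne d (List.mem_cons_of_mem _ h)) hd.2.1
    obtain ⟨P, hP, hPl⟩ := factor_prof f.1 f.2 (hne f (by simp)) hd.1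
    obtain ⟨T, hT, hTl⟩ := P.concat Q (fun a h1 h2 => hd.2.2 a (hP a h1) a (hQ a h2) rfl)
    refine ⟨T, ?_, ?_⟩
    · intro a ha
      rw [List.flatMap_cons, List.mem_append]
      exact (hT a ha).imp (hP a) (hQ a)
    · rw [hTl, hPl, hQl]
      rfl

theorem DME.prof {α : Type} (E : DME α) : ∃ T : Prof α, T.lang = E.lang := by
  obtain ⟨T, -, h⟩ := factors_prof E.factors E.nonemptyDisj E.distinct
  exact ⟨T, h⟩

inductive HasSub {α : Type} : UTree α → UTree α → Prop
  | refl (t : UTree α) : HasSub t t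
  | child (a : α) (ts : List (UTree α)) (t s : UTree α) : t ∈ ts → HasSub t s →
      HasSub (UTree.node a ts) s

theorem HasSub.trans {α : Type} {t s r : UTree α} (h : HasSub t s) (h' : HasSub s r) :
    HasSub t r := by
  induction h with
  | refl => exact h'
  | child a ts t s ht _ ih => exact HasSub.child a ts t r ht (ih h')

theorem Sat.inv {α : Type} {R : α → DME α} {a : α} {ts : List (UTree α)}
    (h : UTree.Sat R (UTree.node a ts)) :
    ((ts.map UTree.label : List α) : Multiset α) ∈ (R a).lang ∧ ∀ t ∈ ts, UTree.Sat R t := by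
  cases h with
  | node _ _ h1 h2 => exact ⟨h1, h2⟩

theorem Sat.sub {α : Type} {R : α → DME α} {t s : UTree α} (h : HasSub t s)
    (ht : UTree.Sat R t) : UTree.Sat R s := by
  induction h with
  | refl => exact ht
  | child a ts t s hm _ ih => exact ih ((Sat.inv ht).2 t hm)

theorem Sat.replace {α : Type} {R : α → DME α} {t s : UTree α} (h : HasSub t s)
    (ht : UTree.Sat R t) (s' : UTree α) (hs' : UTree.Sat R s') (hl : s'.label = s.label) :
    ∃ t', UTree.Sat R t' ∧ t'.label = t.label ∧ HasSub t' s' := by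
  induction h with
  | refl => exact ⟨s', hs', hl, HasSub.refl _⟩
  | child a ts t s hm _ ih =>
    obtain ⟨h1, h2⟩ := Sat.inv ht
    obtain ⟨t', ht', htl, hsub⟩ := ih (h2 t hm) hl
    obtain ⟨l1, l2, rfl⟩ := List.append_of_mem hm
    refine ⟨UTree.node a (l1 ++ t' :: l2), UTree.Sat.node _ _ ?_ ?_, rfl,
      HasSub.child _ _ t' _ (by simp) hsub⟩
    · simpa [htl] using h1
    · intro x hx
      rw [List.mem_append, List.mem_cons] at hx
      rcases hx with hx | rfl | hx
      · exact h2 x (by simp [hx])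
      · exact ht'
      · exact h2 x (by simp [hx])

/-- Words below `a` all of whose symbols are productive. -/
def DMS.W {α : Type} (S : DMS α) (a : α) : Set (Multiset α) :=
  {w | w ∈ (S.rules a).lang ∧ ∀ b ∈ w, ∃ t : UTree α, UTree.Sat S.rules t ∧ t.label = b}

def DMS.Useful {α : Type} (S : DMS α) (a : α) : Prop :=
  ∃ t ∈ S.lang, ∃ s, HasSub t s ∧ s.label = a

def Occ {α : Type} (t : UTree α) (a : α) (w : Multiset α) : Prop :=
  ∃ ts : List (UTree α), HasSub t (UTree.node a ts) ∧
    ((ts.map UTree.label : List α) : Multiset α) = w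

theorem Occ.mem_W {α : Type} {S : DMS α} {t : UTree α} {a : α} {w : Multiset α}
    (h : Occ t a w) (ht : t ∈ S.lang) : w ∈ S.W a := by
  obtain ⟨ts, h1, rfl⟩ := h
  obtain ⟨h2, h3⟩ := Sat.inv (Sat.sub h1 ht.2)
  refine ⟨h2, ?_⟩
  intro b hb
  simp only [Multiset.mem_coe, List.mem_map] at hb
  obtain ⟨t, ht, rfl⟩ := hb
  exact ⟨t, h3 t ht, rfl⟩

theorem DMS.occ_of_W {α : Type} {S : DMS α} {a : α} {w : Multiset α}
    (hu : S.Useful a) (hw : w ∈ S.W a) : ∃ t ∈ S.lang, Occ t a w := by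
  obtain ⟨T, hT, s, hs, hsl⟩ := hu
  obtain ⟨h1, h2⟩ := hw
  have : ∃ ts : List (UTree α), (∀ t ∈ ts, UTree.Sat S.rules t) ∧
      ((ts.map UTree.label : List α) : Multiset α) = w := by
    have : Nonempty (UTree α) := ⟨T⟩
    choose! f hf hf' using h2
    refine ⟨w.toList.map f, ?_, ?_⟩
    · intro t ht
      simp only [List.mem_map, Multiset.mem_toList] at ht
      obtain ⟨b, hb, rfl⟩ := ht
      exact hf b hb
    · have : (w.toList.map f).map UTree.label = w.toList := by
        rw [List.map_map]
        conv_rhs => rw [← List.map_id w.toList]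
        apply List.map_congr_left
        intro b hb
        exact hf' b (Multiset.mem_toList.1 hb)
      rw [this, Multiset.coe_toList]
  obtain ⟨ts, hts, hw⟩ := this
  obtain ⟨t', p1, p2, p3⟩ := Sat.replace hs hT.2 (UTree.node a ts)
    (UTree.Sat.node a ts (by rw [hw]; exact h1) hts) (by rw [hsl]; rfl)
  exact ⟨t', ⟨by rw [p2]; exact hT.1, p1⟩, ts, p3, hw⟩

theorem DMS.exists_cs {α : Type} [Fintype α] (S : DMS α) :
    ∃ CS : Finset (UTree α), (∀ t ∈ CS, t ∈ S.lang) ∧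
      CS.card ≤ Fintype.card α * (Fintype.card α ^ 2 + Fintype.card α + 1) ∧
      ∀ a, S.Useful a → ∃ C, IsCS (S.W a) C ∧ ∀ w ∈ C, ∃ t ∈ CS, Occ t a w := by
  classical
  have : Nonempty α := ⟨S.root⟩
  have key : ∀ a, ∃ F : Finset (UTree α), (∀ t ∈ F, t ∈ S.lang) ∧
      F.card ≤ Fintype.card α ^ 2 + Fintype.card α + 1 ∧
      (S.Useful a → ∃ C, IsCS (S.W a) C ∧ ∀ w ∈ C, ∃ t ∈ F, Occ t a w) := by
    intro a
    by_cases hu : S.Useful a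
    · obtain ⟨P, hP⟩ := (S.rules a).prof
      have hne : ∃ w ∈ P.lang, ∀ b ∈ w, ∃ t : UTree α, UTree.Sat S.rules t ∧ t.label = b := by
        obtain ⟨T, hT, s, hs, hsl⟩ := hu
        obtain ⟨b, ts⟩ := s
        have hsl : b = a := hsl
        subst hsl
        have := Occ.mem_W (S := S) ⟨ts, hs, rfl⟩ hT
        rw [hP]
        exact ⟨_, this.1, this.2⟩
      obtain ⟨C, hC⟩ := IsCS.exists P _ hne
      rw [hP] at hC
      have hC : IsCS (S.W a) C := hC
      have hocc := fun w hw => DMS.occ_of_W hu (hC.sub w hw)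
      have : Nonempty (UTree α) := ⟨UTree.node a []⟩
      choose! f hf hf' using hocc
      refine ⟨C.image f, ?_, Finset.card_image_le.trans hC.card, fun _ => ⟨C, hC, ?_⟩⟩
      · intro t ht
        obtain ⟨w, hw, rfl⟩ := Finset.mem_image.1 ht
        exact hf w hw
      · intro w hw
        exact ⟨f w, Finset.mem_image_of_mem _ hw, hf' w hw⟩
    · exact ⟨∅, by simp, by simp, fun h => absurd h hu⟩
  choose F h1 h2 h3 using key
  refine ⟨Finset.univ.biUnion F, ?_, ?_, ?_⟩
  · intro t ht
    obtain ⟨a, -, ha⟩ := Finset.mem_biUnion.1 ht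
    exact h1 a t ha
  · exact Finset.card_biUnion_le_card_mul _ _ _ (fun a _ => h2 a)
  · intro a ha
    obtain ⟨C, hC, hC'⟩ := h3 a ha
    refine ⟨C, hC, ?_⟩
    intro w hw
    obtain ⟨t, ht, hto⟩ := hC' w hw
    exact ⟨t, Finset.mem_biUnion.2 ⟨a, Finset.mem_univ _, ht⟩, hto⟩

theorem DMS.unique_sub {α : Type} [Fintype α] (S S' : DMS α) (CS CS' D : Finset (UTree α))
    (h : ∀ a, S.Useful a → ∃ C, IsCS (S.W a) C ∧ ∀ w ∈ C, ∃ t ∈ CS, Occ t a w)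
    (h' : ∀ a, S'.Useful a → ∃ C, IsCS (S'.W a) C ∧ ∀ w ∈ C, ∃ t ∈ CS', Occ t a w)
    (hD : D.Nonempty) (hCS : CS ⊆ D) (hCS' : CS' ⊆ D) (hS : ∀ t ∈ D, t ∈ S.lang)
    (hS' : ∀ t ∈ D, t ∈ S'.lang) : S.lang ⊆ S'.lang := by
  have hW : ∀ a, S.Useful a → S'.Useful a → S.W a = S'.W a := by
    intro a ha ha'
    obtain ⟨C, hC, hCo⟩ := h a ha
    obtain ⟨C', hC', hCo'⟩ := h' a ha'
    refine hC.unique hC' ?_ ?_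
    · intro w hw
      obtain ⟨t, ht, ho⟩ := hCo w hw
      exact ho.mem_W (hS' t (hCS ht))
    · intro w hw
      obtain ⟨t, ht, ho⟩ := hCo' w hw
      exact ho.mem_W (hS t (hCS' ht))
  obtain ⟨t0, ht0⟩ := hD
  have hroot : S.root = S'.root := (hS t0 ht0).1.symm.trans (hS' t0 ht0).1
  have main : ∀ t, UTree.Sat S.rules t → (∃ T ∈ S.lang, HasSub T t) → S'.Useful t.label →
      UTree.Sat S'.rules t := by
    intro t ht
    induction ht with
    | node a ts hw hts ih =>
      rintro ⟨T, hT, hTs⟩ hu'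
      have hu : S.Useful a := ⟨T, hT, _, hTs, rfl⟩
      have hu' : S'.Useful a := hu'
      have hw1 : ((ts.map UTree.label : List α) : Multiset α) ∈ S'.W a := by
        rw [← hW a hu hu']
        exact Occ.mem_W ⟨ts, hTs, rfl⟩ hT
      obtain ⟨T', hT', ts', hsub', hw'⟩ := DMS.occ_of_W hu' hw1
      refine UTree.Sat.node a ts hw1.1 ?_
      intro t ht
      refine ih t ht ⟨T, hT, hTs.trans (HasSub.child _ _ _ _ ht (HasSub.refl _))⟩ ?_
      have : t.label ∈ ((ts'.map UTree.label : List α) : Multiset α) := by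
        rw [hw']
        exact Multiset.mem_coe.2 (List.mem_map_of_mem ht)
      rw [Multiset.mem_coe, List.mem_map] at this
      obtain ⟨t', ht', hl⟩ := this
      exact ⟨T', hT', t', hsub'.trans (HasSub.child _ _ _ _ ht' (HasSub.refl _)), hl⟩
  rintro t ⟨ht1, ht2⟩
  refine ⟨ht1.trans hroot, main t ht2 ⟨t, ⟨ht1, ht2⟩, HasSub.refl _⟩ ?_⟩
  exact ⟨t0, hS' t0 ht0, t0, HasSub.refl _, by rw [ht1, (hS t0 ht0).1]⟩

theorem exists_univ {α : Type} [Fintype α] (r : α) :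
    ∃ S : DMS α, ∀ t : UTree α, t.label = r → t ∈ S.lang := by
  classical
  have hne : (Finset.univ : Finset α).toList.map (fun a => (a, Mult.one)) ≠ [] := by
    intro h
    have : r ∈ (Finset.univ : Finset α).toList := by simp
    rw [List.map_eq_nil_iff.1 h] at this
    simp at this
  let E : DME α :=
    { factors := [((Finset.univ : Finset α).toList.map (fun a => (a, Mult.one)), Mult.star)]
      nonemptyDisj := by
        intro d hd
        rw [List.mem_singleton.1 hd]
        exact hne
      distinct := by
        simp [Function.comp_def, Finset.nodup_toList] }
  have hE : ∀ w, w ∈ E.lang := by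
    intro w
    refine ⟨w, ?_, 0, rfl, by simp⟩
    refine (pow_big _ _ (Or.inl rfl) hne w).2 ⟨?_, by simp⟩
    intro a _
    exact ⟨.one, by simp, by simp⟩
  refine ⟨⟨r, fun _ => E⟩, ?_⟩
  have hsat : ∀ t : UTree α, UTree.Sat (fun _ => E) t := by
    intro t
    refine UTree.rec (motive_1 := fun t => UTree.Sat (fun _ => E) t)
      (motive_2 := fun ts => ∀ t ∈ ts, UTree.Sat (fun _ => E) t) ?_ ?_ ?_ t
    · intro a ts ih
      exact UTree.Sat.node a ts (hE _) ih
    · intro t ht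
      simp at ht
    · intro t ts h1 h2 x hx
      rcases List.mem_cons.1 hx with rfl | hx
      · exact h1
      · exact h2 x hx
  intro t ht
  exact ⟨ht, hsat t⟩

/-- The class DMS is learnable from positive examples. -/
theorem dms_learnable_from_positive :
    ∃ p : Polynomial ℕ,
      ∀ (α : Type) [Fintype α],
        ∃ learner : TreeSample α → DMS α,
          (∀ D : TreeSample α, ↑D.val ⊆ (learner D).lang) ∧
          (∀ S : DMS α, ∃ CS : Finset (UTree α),
              ↑CS ⊆ S.lang ∧ CS.card ≤ p.eval (Fintype.card α) ∧
              ∀ (D : Finset (UTree α)) (hne : D.Nonempty)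
                (hr : ∃ r : α, ∀ t ∈ D, t.label = r),
                CS ⊆ D → ↑D ⊆ S.lang →
                (learner ⟨D, hne, hr⟩).lang = S.lang) := by
  classical
  refine ⟨Polynomial.X * (Polynomial.X ^ 2 + Polynomial.X + 1), ?_⟩
  intro α _
  choose CS h1 h2 h3 using fun S : DMS α => S.exists_cs
  have hl : ∀ D : TreeSample α, ∃ S : DMS α, (∀ t ∈ D.val, t ∈ S.lang) ∧
      ((∃ S' : DMS α, CS S' ⊆ D.val ∧ ∀ t ∈ D.val, t ∈ S'.lang) → CS S ⊆ D.val) := by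
    intro D
    by_cases h : ∃ S' : DMS α, CS S' ⊆ D.val ∧ ∀ t ∈ D.val, t ∈ S'.lang
    · obtain ⟨S, hS, hS'⟩ := h
      exact ⟨S, hS', fun _ => hS⟩
    · obtain ⟨r, hr⟩ := D.property.2
      obtain ⟨S, hS⟩ := exists_univ r
      exact ⟨S, fun t ht => hS t (hr t ht), fun h' => absurd h' h⟩
  choose learner hl1 hl2 using hl
  refine ⟨learner, fun D t ht => hl1 D t ht, ?_⟩
  intro S
  refine ⟨CS S, fun t ht => h1 S t ht, ?_, ?_⟩
  · simpa using h2 S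
  · intro D hne hr hCS hD
    have hD : ∀ t ∈ D, t ∈ S.lang := fun t ht => hD ht
    have k1 := hl1 ⟨D, hne, hr⟩
    have k2 := hl2 ⟨D, hne, hr⟩ ⟨S, hCS, hD⟩
    exact Set.Subset.antisymm
      (DMS.unique_sub _ _ _ _ D (h3 _) (h3 _) hne k2 hCS k1 hD)
      (DMS.unique_sub _ _ _ _ D (h3 _) (h3 _) hne hCS k2 hD k1)
end LSXML
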